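/- For every real q > 0, ∫_0^∞ arctan(t)/(e^{2πqt} − 1) dt = 1/2 − (1/2) ln q + (ln q)/(4q) + (ln Γ(q))/(2q) − (ln √(2π))/(2q). -/

import Mathlib

open Real MeasureTheory

lemma integrableOn_id_mul_exp_neg_mul {a : ℝ} (ha : 0 < a) :
    IntegrableOn (fun x : ℝ => x * exp (-(a * x))) (Set.Ioi 0) := by
  simpa using integrableOn_rpow_mul_exp_neg_mul_rpow (s := 1) (p := 1) (by norm_num) (by norm_num) ha

lemma integrableOn_exp_neg_mul {a : ℝ} (ha : 0 < a) :
    IntegrableOn (fun x : ℝ => exp (-(a * x))) (Set.Ioi 0) := by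
  simpa using integrableOn_exp_mul_Ioi (neg_neg_of_pos ha) 0

lemma integral_exp_neg_mul_Ioi_zero {a : ℝ} (ha : 0 < a) :
    ∫ x in Set.Ioi (0 : ℝ), exp (-(a * x)) = 1 / a := by
  simpa using integral_exp_mul_Ioi (neg_neg_of_pos ha) 0

lemma integral_id_mul_exp_neg_mul {a : ℝ} (ha : 0 < a) :
    ∫ x in Set.Ioi (0 : ℝ), x * exp (-(a * x)) = 1 / a ^ 2 := by
  have h := integral_rpow_mul_exp_neg_mul_Ioi (a := 2) (by norm_num) ha
  have h1 : (2 : ℝ) - 1 = 1 := by norm_num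
  simpa [h1, Gamma_two] using h

lemma abs_sin_mul_le {t x : ℝ} (ht : 0 < t) (hx : 0 < x) : |sin (t * x)| ≤ t * x :=
  (abs_sin_le_abs).trans_eq (abs_of_pos (mul_pos ht hx))

lemma integrableOn_exp_neg_mul_sin {a : ℝ} (ha : 0 < a) (b : ℝ) :
    IntegrableOn (fun x : ℝ => exp (-(a * x)) * sin (b * x)) (Set.Ioi 0) := by
  refine (integrableOn_exp_neg_mul ha).mono' (by fun_prop) (.of_forall fun x => ?_)
  rw [norm_mul, norm_of_nonneg (exp_pos _).le]
  exact mul_le_of_le_one_right (exp_pos _).le (abs_sin_le_one _)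

lemma integral_exp_neg_mul_sin {a : ℝ} (ha : 0 < a) (b : ℝ) :
    ∫ x in Set.Ioi (0 : ℝ), exp (-(a * x)) * sin (b * x) = b / (a ^ 2 + b ^ 2) := by
  have hne : a ^ 2 + b ^ 2 ≠ 0 := by positivity
  have hlim : Filter.Tendsto
      (fun x => -(exp (-(a * x)) * (a * sin (b * x) + b * cos (b * x))) / (a ^ 2 + b ^ 2))
      Filter.atTop (nhds 0) := by
    have he : Filter.Tendsto (fun x => (|a| + |b|) / (a ^ 2 + b ^ 2) * exp (-(a * x)))
        Filter.atTop (nhds 0) := by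
      simpa using (tendsto_exp_neg_atTop_nhds_zero.comp
        (Filter.tendsto_id.const_mul_atTop ha)).const_mul ((|a| + |b|) / (a ^ 2 + b ^ 2))
    refine squeeze_zero_norm (fun x => ?_) he
    rw [norm_div, norm_neg, norm_mul, norm_of_nonneg (exp_pos _).le,
      norm_of_nonneg (by positivity : 0 ≤ a ^ 2 + b ^ 2), div_mul_eq_mul_div, mul_comm (exp _)]
    gcongr
    refine (norm_add_le _ _).trans (add_le_add ?_ ?_) <;> rw [norm_mul]
    · exact mul_le_of_le_one_right (abs_nonneg _) (abs_sin_le_one _)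
    · exact mul_le_of_le_one_right (abs_nonneg _) (abs_cos_le_one _)
  have hder : ∀ x ∈ Set.Ici (0 : ℝ), HasDerivAt
      (fun x => -(exp (-(a * x)) * (a * sin (b * x) + b * cos (b * x))) / (a ^ 2 + b ^ 2))
      (exp (-(a * x)) * sin (b * x)) x := fun x _ => by
    have hb : HasDerivAt (fun x => b * x) b x := by simpa using (hasDerivAt_id x).const_mul b
    have ha : HasDerivAt (fun x => -(a * x)) (-a) x := by
      simpa using (hasDerivAt_id x).const_mul (-a)
    refine ((ha.exp.mul ((hb.sin.const_mul a).add (hb.cos.const_mul b))).neg.div_const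
      (a ^ 2 + b ^ 2)).congr_deriv ?_
    simp only [Pi.add_apply]
    symm
    rw [eq_div_iff hne]
    ring
  rw [integral_Ioi_of_hasDerivAt_of_tendsto' hder (integrableOn_exp_neg_mul_sin ha b) hlim]
  simp [neg_div]

lemma mul_exp_le_exp_two_mul_sub_one {s : ℝ} (hs : 0 ≤ s) :
    2 * s * exp s ≤ exp (2 * s) - 1 := by
  have h := self_le_sinh_iff.2 hs
  rw [sinh_eq] at h
  have h1 : exp (2 * s) = exp s * exp s := by rw [← exp_add]; ring_nf
  have h2 : exp (-s) * exp s = 1 := by rw [← exp_add]; simp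
  nlinarith [exp_pos s]

lemma exp_two_pi_mul_sub_one_pos {t : ℝ} (ht : 0 < t) : 0 < exp (2 * π * t) - 1 := by
  have : 0 < 2 * π * t := by positivity
  linarith [one_lt_exp_iff.2 this]

lemma integrableOn_id_div_exp_sub_one :
    IntegrableOn (fun t : ℝ => t / (exp (2 * π * t) - 1)) (Set.Ioi 0) := by
  refine ((integrableOn_exp_neg_mul pi_pos).const_mul (1 / (2 * π))).mono'
    (Measurable.aestronglyMeasurable (by fun_prop)) ?_
  filter_upwards [ae_restrict_mem measurableSet_Ioi] with t ht
  have ht : 0 < t := ht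
  have hp := exp_two_pi_mul_sub_one_pos ht
  rw [norm_of_nonneg (by positivity), div_le_iff₀ hp]
  have h := mul_exp_le_exp_two_mul_sub_one (mul_pos pi_pos ht).le
  have h2 : exp (-(π * t)) * exp (π * t) = 1 := by rw [← exp_add]; simp
  rw [← mul_assoc] at h
  calc t = 1 / (2 * π) * exp (-(π * t)) * (2 * π * t * exp (π * t)) := by
        rw [show 1 / (2 * π) * exp (-(π * t)) * (2 * π * t * exp (π * t)) =
          (2 * π) / (2 * π) * t * (exp (-(π * t)) * exp (π * t)) by ring, h2,
          div_self (by positivity), one_mul, mul_one]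
    _ ≤ _ := by gcongr

lemma hasSum_div_sq_add_sq {x : ℝ} (hx : 0 < x) :
    HasSum (fun n : ℕ => x / ((2 * π * (n + 1)) ^ 2 + x ^ 2))
      (1 / 2 * (1 / (exp x - 1) - 1 / x + 1 / 2)) := by
  set c : ℂ := Complex.I * x / (2 * π) with hc
  have hπ : (π : ℂ) ≠ 0 := by exact_mod_cast pi_ne_zero
  have hxc : (x : ℂ) ≠ 0 := by exact_mod_cast hx.ne'
  have hcz : c ∈ Complex.integerComplement := by
    rintro ⟨n, hn⟩
    have him := congrArg Complex.im hn
    have hcI : c = ((x / (2 * π) : ℝ) : ℂ) * Complex.I := by rw [hc]; push_cast; ring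
    rw [hcI, Complex.im_ofReal_mul, Complex.I_im, Complex.intCast_im] at him
    have : 0 < x / (2 * π) := by positivity
    linarith
  have hsum := (summable_cotTerm hcz).hasSum
  have hval := cot_series_rep' hcz
  have hexp : 2 * (π : ℂ) * Complex.I * c = ((-x : ℝ) : ℂ) := by
    rw [hc]; field_simp; simp [Complex.I_sq]
  have hc2 : c ^ 2 = -(x ^ 2 / (2 * π) ^ 2) := by
    rw [hc, div_pow, mul_pow, Complex.I_sq]; ring
  have hterm (n : ℕ) : cotTerm c n =
      -(4 * π * Complex.I) * ((x / ((2 * π * (n + 1)) ^ 2 + x ^ 2) : ℝ) : ℂ) := by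
    have hden : ((2 * π * (n + 1)) ^ 2 + x ^ 2 : ℂ) ≠ 0 := by
      have : (2 * π * (n + 1)) ^ 2 + x ^ 2 ≠ 0 := by positivity
      exact_mod_cast this
    have hmul : (c + (n + 1)) * (c - (n + 1)) =
        -((2 * π * (n + 1)) ^ 2 + x ^ 2) / (2 * π) ^ 2 := by
      rw [← sq_sub_sq, hc2]
      field_simp
      ring
    rw [cotTerm_identity hcz, hmul, hc]
    push_cast
    field_simp
    ring
  have htsum : ∑' n, cotTerm c n = -(4 * π * Complex.I) *
      ((1 / 2 * (1 / (exp x - 1) - 1 / x + 1 / 2) : ℝ) : ℂ) := by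
    refine hval.symm.trans ?_
    rw [Complex.cot_pi_eq_exp_ratio, hexp, ← Complex.ofReal_exp, exp_neg]
    have he : (exp x : ℂ) - 1 ≠ 0 := by
      have := (one_lt_exp_iff.2 hx)
      exact_mod_cast (sub_pos.2 this).ne'
    have he0 : (exp x : ℂ) ≠ 0 := by exact_mod_cast (exp_pos x).ne'
    have hratio : ((exp x : ℂ)⁻¹ + 1) / (Complex.I * (1 - (exp x : ℂ)⁻¹)) =
        -Complex.I * ((exp x + 1) / (exp x - 1)) := by
      rw [← mul_div_mul_left _ _ he0, mul_add, mul_left_comm, mul_sub, mul_inv_cancel₀ he0,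
        mul_one, ← div_div, div_right_comm, Complex.div_I]
      ring
    have hinv : 1 / c = -Complex.I * (2 * π / x) := by
      rw [hc, one_div_div, ← div_div, div_right_comm, Complex.div_I]
      ring
    rw [Complex.ofReal_inv, hratio, hinv]
    simp only [Complex.ofReal_mul, Complex.ofReal_add, Complex.ofReal_sub, Complex.ofReal_div,
      Complex.ofReal_one, Complex.ofReal_ofNat]
    field_simp
    ring
  rw [htsum] at hsum
  simp_rw [hterm] at hsum
  rw [hasSum_mul_left_iff (by simp [hπ])] at hsum
  exact_mod_cast hsum

lemma hasSum_exp_neg_mul {t : ℝ} (ht : 0 < t) :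
    HasSum (fun n : ℕ => exp (-(2 * π * (n + 1) * t))) (1 / (exp (2 * π * t) - 1)) := by
  have hlt : exp (-(2 * π * t)) < 1 := exp_lt_one_iff.2 (neg_neg_of_pos (by positivity))
  have h := (hasSum_geometric_of_lt_one (exp_pos _).le hlt).mul_left (exp (-(2 * π * t)))
  have hval : exp (-(2 * π * t)) * (1 - exp (-(2 * π * t)))⁻¹ = 1 / (exp (2 * π * t) - 1) := by
    have h1 := exp_two_pi_mul_sub_one_pos ht
    have h2 : 1 - exp (-(2 * π * t)) ≠ 0 := by linarith
    have h3 : exp (-(2 * π * t)) * exp (2 * π * t) = 1 := by rw [← exp_add]; simp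
    rw [← div_eq_mul_inv, div_eq_div_iff h2 h1.ne']
    linear_combination h3
  rw [hval] at h
  refine (funext fun n => ?_ : (fun n : ℕ => exp (-(2 * π * (n + 1) * t))) = _) ▸ h
  rw [← exp_nat_mul, ← exp_add]
  ring_nf

lemma integral_sin_div_exp_sub_one {x : ℝ} (hx : 0 < x) :
    ∫ t in Set.Ioi (0 : ℝ), sin (t * x) / (exp (2 * π * t) - 1) =
      1 / 2 * (1 / (exp x - 1) - 1 / x + 1 / 2) := by
  have ha (n : ℕ) : 0 < 2 * π * ((n : ℝ) + 1) := by positivity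
  have hf_int (n : ℕ) : IntegrableOn (fun t => exp (-(2 * π * (n + 1) * t)) * sin (x * t))
      (Set.Ioi 0) := integrableOn_exp_neg_mul_sin (ha n) x
  have hsummable : Summable fun n : ℕ =>
      ∫ t in Set.Ioi (0 : ℝ), ‖exp (-(2 * π * (n + 1) * t)) * sin (x * t)‖ := by
    have hs : Summable fun n : ℕ => x * (1 / (2 * π * ((n : ℝ) + 1)) ^ 2) := by
      have h := ((summable_nat_add_iff 1).2
        (summable_one_div_nat_pow.2 (one_lt_two))).mul_left (x / (2 * π) ^ 2)
      refine h.congr fun n => ?_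
      push_cast
      field_simp
    refine hs.of_nonneg_of_le (fun n => integral_nonneg fun t => norm_nonneg _) fun n => ?_
    rw [← integral_id_mul_exp_neg_mul (ha n), ← integral_const_mul]
    refine setIntegral_mono_on (hf_int n).norm
      ((integrableOn_id_mul_exp_neg_mul (ha n)).const_mul x) measurableSet_Ioi fun t ht => ?_
    have h := abs_sin_mul_le hx ht
    rw [norm_mul, norm_of_nonneg (exp_pos _).le, norm_eq_abs, mul_comm, ← mul_assoc]
    gcongr
  have h := hasSum_integral_of_summable_integral_norm hf_int hsummable
  simp_rw [integral_exp_neg_mul_sin (ha _)] at h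
  rw [(hasSum_div_sq_add_sq hx).unique h]
  refine setIntegral_congr_fun measurableSet_Ioi fun t ht => ?_
  rw [((hasSum_exp_neg_mul ht).mul_right (sin (x * t))).tsum_eq, mul_comm t]
  ring

lemma integrable_exp_neg_mul_sin_div_prod {z : ℝ} (hz : 0 < z) :
    Integrable (Function.uncurry fun t x : ℝ =>
      exp (-(z * x)) * sin (t * x) / (exp (2 * π * t) - 1))
      ((volume.restrict (Set.Ioi 0)).prod (volume.restrict (Set.Ioi 0))) := by
  refine (Integrable.mul_prod integrableOn_id_div_exp_sub_one
    (integrableOn_id_mul_exp_neg_mul hz)).mono'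
    (Measurable.aestronglyMeasurable (by unfold Function.uncurry; fun_prop)) ?_
  rw [Measure.prod_restrict]
  filter_upwards [ae_restrict_mem (measurableSet_Ioi.prod measurableSet_Ioi)] with p hp
  obtain ⟨t, x⟩ := p
  have ht : 0 < t := hp.1
  have hx : 0 < x := hp.2
  have h := abs_sin_mul_le ht hx
  have hw := exp_two_pi_mul_sub_one_pos ht
  simp only [Function.uncurry]
  rw [norm_div, norm_mul, norm_of_nonneg (exp_pos _).le, norm_of_nonneg hw.le, norm_eq_abs]
  calc _ ≤ exp (-(z * x)) * (t * x) / (exp (2 * π * t) - 1) := by gcongr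
    _ = _ := by ring

lemma integrableOn_exp_neg_mul_binet {z : ℝ} (hz : 0 < z) :
    IntegrableOn (fun x => exp (-(z * x)) * (1 / 2 * (1 / (exp x - 1) - 1 / x + 1 / 2)))
      (Set.Ioi 0) := by
  refine (integrable_exp_neg_mul_sin_div_prod hz).integral_prod_right.congr ?_
  filter_upwards [ae_restrict_mem measurableSet_Ioi] with x hx
  simp only [Function.uncurry]
  simp_rw [mul_div_assoc]
  rw [integral_const_mul, integral_sin_div_exp_sub_one hx]

lemma integral_div_sq_add_sq_mul_exp_sub_one {z : ℝ} (hz : 0 < z) :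
    ∫ t in Set.Ioi (0 : ℝ), t / (z ^ 2 + t ^ 2) / (exp (2 * π * t) - 1) =
      ∫ x in Set.Ioi (0 : ℝ),
        exp (-(z * x)) * (1 / 2 * (1 / (exp x - 1) - 1 / x + 1 / 2)) := by
  simp_rw [← integral_exp_neg_mul_sin hz, ← integral_div]
  rw [integral_integral_swap (integrable_exp_neg_mul_sin_div_prod hz)]
  refine setIntegral_congr_fun measurableSet_Ioi fun x hx => ?_
  simp_rw [mul_div_assoc]
  rw [integral_const_mul, integral_sin_div_exp_sub_one hx]

lemma integral_inv_mul_exp_sub_exp {a b : ℝ} (ha : 0 < a) (hb : 0 < b)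
    (hf_int : IntegrableOn (fun x => x⁻¹ • (exp (-(a * x)) - exp (-(b * x)))) (Set.Ioi 0)) :
    ∫ x in Set.Ioi (0 : ℝ), x⁻¹ • (exp (-(a * x)) - exp (-(b * x))) = log (b / a) := by
  have hc : Continuous fun x : ℝ => exp (-x) := by fun_prop
  have h := Frullani.integral_Ioi_eq (f := fun x => exp (-x)) (L := 1) (R := 0)
    (hc.locallyIntegrable.locallyIntegrableOn _) ha hb
    ((hc.tendsto' 0 1 (by simp)).mono_left nhdsWithin_le_nhds)
    tendsto_exp_neg_atTop_nhds_zero hf_int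
  simpa using h

lemma integral_div_sq_add_sq_sub {z : ℝ} (hz : 0 < z) :
    (∫ t in Set.Ioi (0 : ℝ), t / (z ^ 2 + t ^ 2) / (exp (2 * π * t) - 1)) -
      ∫ t in Set.Ioi (0 : ℝ), t / ((z + 1) ^ 2 + t ^ 2) / (exp (2 * π * t) - 1) =
      1 / 2 * (1 / 2 * (1 / z + 1 / (z + 1)) - log ((z + 1) / z)) := by
  have hz1 : 0 < z + 1 := by linarith
  have he := integrableOn_exp_neg_mul hz
  have he1 := integrableOn_exp_neg_mul hz1
  have hB := integrableOn_exp_neg_mul_binet hz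
  have hB1 := integrableOn_exp_neg_mul_binet hz1
  have hpt : Set.EqOn (fun x => x⁻¹ • (exp (-(z * x)) - exp (-((z + 1) * x))))
      (fun x => 1 / 2 * (exp (-(z * x)) + exp (-((z + 1) * x))) -
        2 * (exp (-(z * x)) * (1 / 2 * (1 / (exp x - 1) - 1 / x + 1 / 2)) -
          exp (-((z + 1) * x)) * (1 / 2 * (1 / (exp x - 1) - 1 / x + 1 / 2)))) (Set.Ioi 0) := by
    intro x hx
    have hx : 0 < x := hx
    have hex : exp x - 1 ≠ 0 := (sub_pos.2 (one_lt_exp_iff.2 hx)).ne'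
    have h1 : exp (-(z * x)) = exp (-((z + 1) * x)) * exp x := by rw [← exp_add]; ring_nf
    simp only [smul_eq_mul]
    rw [h1]
    field_simp
    ring
  have hadd : IntegrableOn (fun x => 1 / 2 * (exp (-(z * x)) + exp (-((z + 1) * x))))
      (Set.Ioi 0) := (he.add he1).const_mul (1 / 2)
  have hsub : IntegrableOn (fun x =>
      2 * (exp (-(z * x)) * (1 / 2 * (1 / (exp x - 1) - 1 / x + 1 / 2)) -
        exp (-((z + 1) * x)) * (1 / 2 * (1 / (exp x - 1) - 1 / x + 1 / 2))))
      (Set.Ioi 0) := (hB.sub hB1).const_mul 2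
  have hF := integral_inv_mul_exp_sub_exp hz hz1
    (IntegrableOn.congr_fun (hadd.sub hsub) hpt.symm measurableSet_Ioi)
  rw [setIntegral_congr_fun measurableSet_Ioi hpt,
    integral_sub hadd hsub,
    integral_const_mul, integral_const_mul, integral_add he he1, integral_sub hB hB1,
    integral_exp_neg_mul_Ioi_zero hz, integral_exp_neg_mul_Ioi_zero hz1] at hF
  rw [integral_div_sq_add_sq_mul_exp_sub_one hz, integral_div_sq_add_sq_mul_exp_sub_one hz1]
  linarith

open Filter Topology in
lemma eq_zero_of_hasDerivAt_zero_of_tendsto {f : ℝ → ℝ}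
    (hf : ∀ x, 0 < x → HasDerivAt f 0 x) (hlim : Tendsto f atTop (𝓝 0)) {x : ℝ} (hx : 0 < x) :
    f x = 0 := by
  obtain ⟨a, ha⟩ := isOpen_Ioi.exists_is_const_of_deriv_eq_zero (convex_Ioi (0 : ℝ)).isPreconnected
    (fun y hy => (hf y hy).differentiableAt.differentiableWithinAt) (fun y hy => (hf y hy).deriv)
  have h : Tendsto f atTop (𝓝 a) :=
    tendsto_const_nhds.congr' ((eventually_gt_atTop 0).mono fun y hy => (ha y hy).symm)
  rw [ha x hx, tendsto_nhds_unique h hlim]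

lemma arctan_le_self {x : ℝ} (hx : 0 ≤ x) : arctan x ≤ x :=
  (le_tan (arctan_nonneg.2 hx) (arctan_lt_pi_div_two x)).trans_eq (tan_arctan x)

lemma arctan_div_div_exp_sub_one_le {z t : ℝ} (hz : 0 < z) (ht : 0 < t) :
    arctan (t / z) / (exp (2 * π * t) - 1) ≤ 1 / z * (t / (exp (2 * π * t) - 1)) := by
  have hw := exp_two_pi_mul_sub_one_pos ht
  have h := arctan_le_self (div_pos ht hz).le
  calc _ ≤ t / z / (exp (2 * π * t) - 1) := by gcongr
    _ = _ := by ring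

lemma arctan_div_div_exp_sub_one_nonneg {z t : ℝ} (hz : 0 < z) (ht : 0 < t) :
    0 ≤ arctan (t / z) / (exp (2 * π * t) - 1) :=
  div_nonneg (arctan_nonneg.2 (div_pos ht hz).le) (exp_two_pi_mul_sub_one_pos ht).le

lemma integrableOn_arctan_div_div_exp_sub_one {z : ℝ} (hz : 0 < z) :
    IntegrableOn (fun t => arctan (t / z) / (exp (2 * π * t) - 1)) (Set.Ioi 0) := by
  refine (integrableOn_id_div_exp_sub_one.const_mul (1 / z)).mono'
    (Measurable.aestronglyMeasurable (by fun_prop)) ?_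
  filter_upwards [ae_restrict_mem measurableSet_Ioi] with t ht
  rw [norm_of_nonneg (arctan_div_div_exp_sub_one_nonneg hz ht)]
  exact arctan_div_div_exp_sub_one_le hz ht

/-- Half of the Binet remainder `log Γ(z) - ((z - 1/2) log z - z + log (2π) / 2)`, as an
integral. -/
noncomputable def binetIntegral (z : ℝ) : ℝ :=
  ∫ t in Set.Ioi (0 : ℝ), arctan (t / z) / (exp (2 * π * t) - 1)

open Filter Topology in
lemma tendsto_binetIntegral_atTop : Tendsto binetIntegral atTop (𝓝 0) := by
  set C := ∫ t in Set.Ioi (0 : ℝ), t / (exp (2 * π * t) - 1)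
  have hC : Tendsto (fun z : ℝ => 1 / z * C) atTop (𝓝 0) := by
    simpa using (tendsto_inv_atTop_zero (𝕜 := ℝ)).mul_const C
  refine squeeze_zero' ?_ ?_ hC
  · filter_upwards [eventually_gt_atTop 0] with z hz
    exact setIntegral_nonneg measurableSet_Ioi fun t ht =>
      arctan_div_div_exp_sub_one_nonneg hz ht
  · filter_upwards [eventually_gt_atTop 0] with z hz
    rw [← integral_const_mul]
    exact setIntegral_mono_on (integrableOn_arctan_div_div_exp_sub_one hz)
      (integrableOn_id_div_exp_sub_one.const_mul _) measurableSet_Ioi fun t ht =>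
      arctan_div_div_exp_sub_one_le hz ht

lemma hasDerivAt_binetIntegral {z : ℝ} (hz : 0 < z) :
    HasDerivAt binetIntegral
      (-∫ t in Set.Ioi (0 : ℝ), t / (z ^ 2 + t ^ 2) / (exp (2 * π * t) - 1)) z := by
  rw [← integral_neg]
  have hz2 : 0 < z / 2 := half_pos hz
  refine (hasDerivAt_integral_of_dominated_loc_of_deriv_le (s := Set.Ioi (z / 2))
    (F := fun z t => arctan (t / z) / (exp (2 * π * t) - 1))
    (F' := fun z t => -(t / (z ^ 2 + t ^ 2) / (exp (2 * π * t) - 1)))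
    (bound := fun t => 1 / (z / 2) ^ 2 * (t / (exp (2 * π * t) - 1)))
    (Ioi_mem_nhds (half_lt_self hz))
    (.of_forall fun y => Measurable.aestronglyMeasurable (by fun_prop))
    (integrableOn_arctan_div_div_exp_sub_one hz)
    (Measurable.aestronglyMeasurable (by fun_prop)) ?_
    (integrableOn_id_div_exp_sub_one.const_mul _) ?_).2
  · filter_upwards [ae_restrict_mem measurableSet_Ioi] with t ht y hy
    have ht : 0 < t := ht
    have hy : z / 2 < y := hy
    have hw := exp_two_pi_mul_sub_one_pos ht
    rw [norm_neg, norm_of_nonneg (by positivity)]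
    calc t / (y ^ 2 + t ^ 2) / (exp (2 * π * t) - 1)
        ≤ t / (z / 2) ^ 2 / (exp (2 * π * t) - 1) := by
          gcongr
          nlinarith
      _ = _ := by ring
  · filter_upwards [ae_restrict_mem measurableSet_Ioi] with t ht y hy
    have ht : 0 < t := ht
    have hy0 : y ≠ 0 := (hz2.trans hy).ne'
    have h := (((hasDerivAt_inv hy0).const_mul t).arctan).div_const (exp (2 * π * t) - 1)
    simp only [← div_eq_mul_inv] at h
    refine h.congr_deriv ?_
    rw [← neg_div]
    congr 1
    field_simp

open Filter Topology in
lemma binetIntegral_sub_binetIntegral_add_one {z : ℝ} (hz : 0 < z) :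
    binetIntegral z - binetIntegral (z + 1) =
      1 / 2 * ((z + 1 / 2) * log (1 + 1 / z) - 1) := by
  rw [← sub_eq_zero]
  refine eq_zero_of_hasDerivAt_zero_of_tendsto (f := fun z => binetIntegral z -
    binetIntegral (z + 1) - 1 / 2 * ((z + 1 / 2) * log (1 + 1 / z) - 1)) (fun x hx => ?_) ?_ hz
  · have hx1 : 0 < x + 1 := by linarith
    have hpos : 0 < 1 + x⁻¹ := by positivity
    have h1 := (hasDerivAt_binetIntegral hx1).comp_add_const x 1
    have h2 := (((hasDerivAt_id x).add_const (1 / 2)).mul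
      (((hasDerivAt_inv hx.ne').const_add 1).log hpos.ne')).sub_const 1
    have h := ((hasDerivAt_binetIntegral hx).sub h1).sub (h2.const_mul (1 / 2))
    simp only [one_div] at h ⊢
    refine h.congr_deriv ?_
    have hK := integral_div_sq_add_sq_sub hx
    have hL : log (1 + x⁻¹) = log ((x + 1) / x) := by congr 1; field_simp
    have hR : (x + 2⁻¹) * (-(x ^ 2)⁻¹ / (1 + x⁻¹)) = -(1 / 2 * (1 / x + 1 / (x + 1))) := by
      field_simp
      ring
    rw [id, hR, hL]
    linear_combination -hK
  · have h1 := tendsto_binetIntegral_atTop.comp (tendsto_atTop_add_const_right _ (1 : ℝ) tendsto_id)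
    have h2 := tendsto_mul_log_one_add_div_atTop 1
    have h3 : Tendsto (fun x : ℝ => log (1 + 1 / x)) atTop (𝓝 0) := by
      have : Tendsto (fun x : ℝ => 1 + 1 / x) atTop (𝓝 1) := by
        simpa using (tendsto_inv_atTop_zero (𝕜 := ℝ)).const_add 1
      simpa using this.log one_ne_zero
    have h := (tendsto_binetIntegral_atTop.sub h1).sub
      (((h2.add (h3.const_mul (1 / 2))).sub_const 1).const_mul (1 / 2))
    simp only [mul_zero, add_zero, sub_self] at h
    refine h.congr fun x => ?_
    simp only [Function.comp, id]
    ring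

/-- The error term in Stirling's approximation of `log Γ`. -/
noncomputable def logGammaRemainder (z : ℝ) : ℝ :=
  log (Gamma z) - (z - 1 / 2) * log z + z - log (2 * π) / 2

lemma logGammaRemainder_sub_logGammaRemainder_add_one {z : ℝ} (hz : 0 < z) :
    logGammaRemainder z - logGammaRemainder (z + 1) = (z + 1 / 2) * log (1 + 1 / z) - 1 := by
  have h : log (1 + 1 / z) = log (z + 1) - log z := by
    rw [← log_div (by positivity) hz.ne']
    congr 1
    field_simp
  rw [h, logGammaRemainder, logGammaRemainder, Gamma_add_one hz.ne',
    log_mul hz.ne' (Gamma_pos_of_pos hz).ne']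
  ring

open Filter Topology in
lemma tendsto_logGammaRemainder_add_nat {z : ℝ} (hz : 0 < z) :
    Tendsto (fun n : ℕ => logGammaRemainder (z + (n + 1 : ℕ))) atTop (𝓝 0) := by
  have hΓ := (BohrMollerup.tendsto_log_gamma hz).const_sub (log (Gamma z))
  have hS := ((Stirling.tendsto_stirlingSeq_sqrt_pi).log (by positivity)).sub_const (log √π)
  have hn := (tendsto_mul_log_one_add_div_atTop (z + 1)).comp
    (tendsto_natCast_atTop_atTop (R := ℝ))
  have hinv := tendsto_inv_atTop_nhds_zero_nat (𝕜 := ℝ)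
  have hrest := (hn.mul (hinv.const_mul (z + 1 / 2)))
  have h := ((hΓ.add hS).sub (hn.add hrest)).add_const (z + 1)
  have hzero : log (Gamma z) - log (Gamma z) + (log √π - log √π) -
      ((z + 1) + (z + 1) * ((z + 1 / 2) * 0)) + (z + 1) = 0 := by ring
  rw [hzero] at h
  refine h.congr' ?_
  filter_upwards [eventually_gt_atTop 0] with n hn0
  have hn0 : (0 : ℝ) < n := by exact_mod_cast hn0
  have hrec := BohrMollerup.f_add_nat_eq (f := log ∘ Gamma) (x := z) (fun {y} hy => by
    rw [Function.comp_apply, Gamma_add_one hy.ne', log_mul hy.ne' (Gamma_pos_of_pos hy).ne',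
      add_comm, Function.comp_apply]) hz (n + 1)
  have hlog : log (1 + (z + 1) / n) = log (z + (n + 1 : ℕ)) - log n := by
    rw [← log_div (by positivity) hn0.ne']
    congr 1
    push_cast
    field_simp
    ring
  simp only [Function.comp_apply] at hrec ⊢
  rw [hlog, logGammaRemainder, hrec, BohrMollerup.logGammaSeq, Stirling.log_stirlingSeq_formula,
    log_div hn0.ne' (exp_pos 1).ne', log_exp, log_mul two_ne_zero hn0.ne',
    log_mul two_ne_zero pi_ne_zero, log_sqrt pi_pos.le]
  push_cast
  field_simp
  ring

open Filter Topology in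
/-- **Binet's second formula** for `log Γ`. -/
theorem logGammaRemainder_eq_two_mul_binetIntegral {z : ℝ} (hz : 0 < z) :
    logGammaRemainder z = 2 * binetIntegral z := by
  have hstep (n : ℕ) : logGammaRemainder (z + n) - 2 * binetIntegral (z + n) =
      logGammaRemainder z - 2 * binetIntegral z := by
    induction n with
    | zero => simp
    | succ n ih =>
      have hzn : 0 < z + n := by positivity
      have h1 := logGammaRemainder_sub_logGammaRemainder_add_one hzn
      have h2 := binetIntegral_sub_binetIntegral_add_one hzn
      rw [← ih]
      push_cast
      rw [← add_assoc]
      linarith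
  have hJ := tendsto_binetIntegral_atTop.comp (tendsto_atTop_add_const_left _ z
    ((tendsto_natCast_atTop_atTop (R := ℝ)).comp (tendsto_add_atTop_nat 1)))
  have h := (tendsto_logGammaRemainder_add_nat hz).sub (hJ.const_mul 2)
  have hc : Tendsto (fun _ : ℕ => logGammaRemainder z - 2 * binetIntegral z) atTop (𝓝 0) := by
    simpa using h.congr fun n => hstep (n + 1)
  exact sub_eq_zero.1 (tendsto_nhds_unique tendsto_const_nhds hc)

theorem integral_T0 (q : ℝ) (hq : 0 < q) :
    ∫ t in Set.Ioi (0 : ℝ), Real.arctan t / (Real.exp (2 * π * q * t) - 1) =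
      1 / 2 - (1 / 2) * Real.log q + Real.log q / (4 * q) +
        Real.log (Real.Gamma q) / (2 * q) - Real.log (Real.sqrt (2 * π)) / (2 * q) := by
  have hscale := integral_comp_mul_left_Ioi
    (fun t => arctan (t / q) / (exp (2 * π * t) - 1)) 0 hq
  simp only [mul_div_cancel_left₀ _ hq.ne', ← mul_assoc, mul_zero, smul_eq_mul] at hscale
  have hB := logGammaRemainder_eq_two_mul_binetIntegral hq
  rw [logGammaRemainder, binetIntegral] at hB
  rw [hscale, log_sqrt (by positivity), eq_div_of_mul_eq two_ne_zero ((mul_comm _ _).trans hB.symm)]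
  field_simp
  ring
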